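/- Let G be a finite group, k an algebraically closed field of characteristic r, H ≤ G with r not dividing |H|, and V a kG-module. Then for all n ≥ 2, H^n(G, V) ≅ Ext_G^{n-1}(V*, P/k) ≅ H^{n-1}(G, V ⊗ (P/k)), where P = Ind_H^G k. -/

import Mathlib

/-- The quotient representation on `V ⧸ W` for a `G`-invariant subspace `W`. -/
noncomputable def Representation.quot {k G V : Type} [Field k] [Group G] [AddCommGroup V]
    [Module k V] (ρ : Representation k G V) (W : Submodule k V)
    (hW : ∀ g : G, W ≤ W.comap (ρ g)) : Representation k G (V ⧸ W) where
  toFun g := W.mapQ W (ρ g) (hW g)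
  map_one' := by
    apply Submodule.linearMap_qext; ext v; simp [Submodule.mapQ_apply]
  map_mul' g h := by
    apply Submodule.linearMap_qext; ext v; simp [Submodule.mapQ_apply]

/-- The permutation module `P = Ind_H^G k` on the cosets of `H`, as a representation. -/
noncomputable def permRep (k G : Type) [Field k] [Group G] (H : Subgroup G) : Rep k G :=
  Rep.ofMulAction k G (G ⧸ H)

/-- The quotient `P / P^G` of the permutation module on cosets of `H` by its
`G`-fixed submodule. -/
noncomputable def permQuot (k G : Type) [Field k] [Group G] (H : Subgroup G) : Rep k G :=
  Rep.of ((Representation.ofMulAction k G (G ⧸ H)).quot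
    (Representation.invariants (Representation.ofMulAction k G (G ⧸ H)))
    (fun g v hv => by
      rw [Submodule.mem_comap,
        (Representation.mem_invariants (Representation.ofMulAction k G (G ⧸ H)) v).mp hv g]
      exact hv))

open CategoryTheory MonoidalCategory

universe u

namespace Rep

section Tensor

variable {k G : Type u} [Field k] [Group G]

theorem shortExact_of_exact {S : ShortComplex (Rep.{u} k G)}
    (hf : Function.Injective S.f.hom) (hfg : Function.Exact S.f.hom S.g.hom)
    (hg : Function.Surjective S.g.hom) : S.ShortExact where
  exact := (S.exact_map_iff_of_faithful (forget₂ (Rep k G) (ModuleCat k))).1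
    ((ShortComplex.ShortExact.moduleCat_exact_iff_function_exact _).2 hfg)
  mono_f := (mono_iff_injective _).2 hf
  epi_g := (epi_iff_surjective _).2 hg

theorem ShortExact.map_tensorLeft {S : ShortComplex (Rep.{u} k G)} (hS : S.ShortExact)
    (A : Rep.{u} k G) : (S.map (tensorLeft A)).ShortExact := by
  have hfg : Function.Exact S.f.hom.toLinearMap S.g.hom.toLinearMap :=
    (ShortComplex.ShortExact.moduleCat_exact_iff_function_exact _).1
      (hS.exact.map (forget₂ (Rep k G) (ModuleCat k)))
  exact shortExact_of_exact
    (Module.Flat.lTensor_preserves_injective_linearMap S.f.hom.toLinearMap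
      ((mono_iff_injective _).1 hS.mono_f))
    (Module.Flat.lTensor_exact A.V hfg)
    (LinearMap.lTensor_surjective A.V ((epi_iff_surjective _).1 hS.epi_g))

instance (A : Rep.{u} k G) : (tensorLeft A).PreservesHomology :=
  ((tensorLeft A).exact_tfae.out 0 2).1 fun _ hS ↦ ShortExact.map_tensorLeft hS A

instance (A : Rep.{u} k G) : (ihom A).PreservesEpimorphisms where
  preserves {_ Y} f hf := (epi_iff_surjective _).2 fun (φ : A.V →ₗ[k] Y.V) ↦
    Module.projective_lifting_property f.hom.toLinearMap φ ((epi_iff_surjective f).1 hf)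

instance (A : Rep.{u} k G) : (tensorLeft A).PreservesProjectiveObjects :=
  Functor.preservesProjectiveObjects_of_adjunction_of_preservesEpimorphisms
    (ihom.adjunction A)

/-- For a projective resolution `P`, the complex `Hom(A ⊗ P, Y)` is `Hom(P, Hom(A, Y))`. -/
noncomputable def linearYonedaObjTensorLeftIso (A Y : Rep.{u} k G)
    (X : Rep.{u} k G) (P : ProjectiveResolution X) :
    ((tensorLeft A).mapProjectiveResolution P).complex.linearYonedaObj k Y ≅
      P.complex.linearYonedaObj k ((ihom A).obj Y) :=
  HomologicalComplex.Hom.isoOfComponents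
    (fun i ↦ (MonoidalClosed.linearHomEquiv A (P.complex.X i) Y).toModuleIso) fun i j _ ↦
      ModuleCat.hom_ext (LinearMap.ext fun f ↦
        ((ihom.adjunction A).homEquiv_naturality_left (P.complex.d j i) f).symm)

/-- `Extⁿ(A ⊗ X, Y)` is `Extⁿ(X, Hom(A, Y))`. -/
noncomputable def extTensorIso (A X Y : Rep.{u} k G) (n : ℕ) :
    ((Ext k (Rep.{u} k G) n).obj (Opposite.op (A ⊗ X))).obj Y ≅
      ((Ext k (Rep.{u} k G) n).obj (Opposite.op X)).obj ((ihom A).obj Y) :=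
  ((tensorLeft A).mapProjectiveResolution (projectiveResolution X)).isoExt n Y ≪≫
    (HomologicalComplex.homologyFunctor _ _ n).mapIso
      (linearYonedaObjTensorLeftIso A Y X (projectiveResolution X)) ≪≫
    ((projectiveResolution X).isoExt n _).symm

/-- A finite-dimensional representation is isomorphic to its double dual. -/
noncomputable def doubleDualIso (V : Rep.{u} k G) [FiniteDimensional k V] :
    V ≅ Rep.of V.ρ.dual.dual :=
  mkIso (.mk (Module.evalEquiv k V) fun g ↦ by
    ext v f
    simp [Representation.dual_apply, Module.Dual.transpose_apply])

/-- For `V` finite-dimensional, `V ⊗ Y` is isomorphic to `Hom(V*, Y)`. -/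
noncomputable def tensorIsoIhomDual (V Y : Rep.{u} k G) [FiniteDimensional k V] :
    V ⊗ Y ≅ (ihom (Rep.of V.ρ.dual)).obj Y :=
  whiskerRightIso (doubleDualIso V) Y ≪≫
    mkIso (.mk (dualTensorHomEquiv k _ _) (Representation.dualTensorHom_comm V.ρ.dual Y.ρ))

/-- For `V` finite-dimensional, `Hⁿ(G, V ⊗ Y)` is `Extⁿ(V*, Y)`. -/
noncomputable def groupCohomologyTensorIsoExt (V Y : Rep.{u} k G) [FiniteDimensional k V]
    (n : ℕ) :
    groupCohomology (V ⊗ Y) n ≅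
      ((Ext k (Rep.{u} k G) n).obj (Opposite.op (Rep.of V.ρ.dual))).obj Y :=
  groupCohomologyIsoExt _ n ≪≫
    ((Ext k (Rep.{u} k G) n).obj _).mapIso (tensorIsoIhomDual V Y) ≪≫
    (extTensorIso (Rep.of V.ρ.dual) (𝟙_ _) Y n).symm ≪≫
    (((Ext k (Rep.{u} k G) n).mapIso (ρ_ (Rep.of V.ρ.dual)).symm.op).app Y)

end Tensor

section RelativelyProjective

variable {k G : Type u} [CommRing k] [Group G] [Fintype G]

/-- If a linear endomorphism `e` of `A` satisfies `∑ g, g⁻¹ e g = 1`, then `A` is a retract of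
the representation coinduced from the trivial subgroup by `A`. -/
noncomputable def retractCoind (A : Rep.{u} k G) (e : A.V →ₗ[k] A.V)
    (he : ∑ g : G, A.ρ g⁻¹ ∘ₗ e ∘ₗ A.ρ g = LinearMap.id) :
    Retract A (coind (⊥ : Subgroup G).subtype (res (⊥ : Subgroup G).subtype A)) where
  i := ofHom ⟨{
      toFun a := ⟨fun x ↦ A.ρ x a, fun g x ↦ by simp⟩
      map_add' _ _ := by ext; simp
      map_smul' _ _ := by ext; simp }, fun g ↦ by
      ext a x
      exact LinearMap.congr_fun (A.ρ.map_mul x g).symm a⟩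
  r := ofHom ⟨∑ g : G, A.ρ g⁻¹ ∘ₗ e ∘ₗ LinearMap.proj g ∘ₗ Submodule.subtype _, fun g ↦ by
      ext f
      simp only [LinearMap.coe_comp, Function.comp_apply, LinearMap.sum_apply, map_sum]
      refine Fintype.sum_equiv (Equiv.mulRight g) _ _ fun x ↦ ?_
      rw [Equiv.coe_mulRight, mul_inv_rev, A.ρ_mul, LinearMap.comp_apply,
        Representation.self_inv_apply]
      rfl⟩
  retract := by
    ext a
    simpa using LinearMap.congr_fun he a

theorem isZero_groupCohomology_succ_of_sum_conj_eq_id (A : Rep.{u} k G) (e : A.V →ₗ[k] A.V)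
    (he : ∑ g : G, A.ρ g⁻¹ ∘ₗ e ∘ₗ A.ρ g = LinearMap.id) (n : ℕ) :
    Limits.IsZero (groupCohomology A (n + 1)) := by
  let R := (retractCoind A e he).map (groupCohomology.functor k G (n + 1))
  change Limits.IsZero ((groupCohomology.functor k G (n + 1)).obj A)
  exact .of_mono R.i
    ((isZero_groupCohomology_succ_of_subsingleton _ n).of_iso (groupCohomology.coindIso _ _))

end RelativelyProjective

section PermutationModule

variable {k G : Type} [Field k] [Group G] (H : Subgroup G)

theorem card_filter_smul_eq_one [Fintype G] [DecidableEq (G ⧸ H)] (x : G ⧸ H) :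
    (Finset.univ.filter fun g : G ↦ g • x = (1 : G)).card = Nat.card H := by
  obtain ⟨a, rfl⟩ := QuotientGroup.mk_surjective x
  rw [← Fintype.card_subtype, ← Nat.card_eq_fintype_card]
  refine Nat.card_congr ((Equiv.mulRight a).subtypeEquiv fun g ↦ ?_)
  rw [MulAction.Quotient.smul_coe, eq_comm, QuotientGroup.eq]
  simp

/-- The projection of `P` to the line spanned by the coset `H`, divided by `|H|`. -/
noncomputable def cosetProj (k : Type) [Field k] : (permRep k G H).V →ₗ[k] (permRep k G H).V :=
  (Nat.card H : k)⁻¹ • ((MonoidAlgebra.coeffLinearEquiv k).symm.toLinearMap ∘ₗ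
    Finsupp.lsingle ((1 : G) : G ⧸ H) ∘ₗ Finsupp.lapply ((1 : G) : G ⧸ H) ∘ₗ
      (MonoidAlgebra.coeffLinearEquiv k).toLinearMap)

theorem coeff_cosetProj [DecidableEq (G ⧸ H)] (p : MonoidAlgebra k (G ⧸ H)) (x : G ⧸ H) :
    MonoidAlgebra.coeff (cosetProj H k p) x =
      if x = (1 : G) then (Nat.card H : k)⁻¹ * p.coeff x else 0 := by
  change (Nat.card H : k)⁻¹ * Finsupp.single _ _ x = _
  rw [Finsupp.single_apply]
  split_ifs with h h' h'
  · rw [← h]; rfl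
  · exact (h' h.symm).elim
  · exact (h h'.symm).elim
  · simp

theorem sum_conj_cosetProj [Fintype G] (hH : (Nat.card H : k) ≠ 0) (p : (permRep k G H).V) :
    ∑ g : G, (permRep k G H).ρ g⁻¹ (cosetProj H k ((permRep k G H).ρ g p)) = p := by
  classical
  refine MonoidAlgebra.ext (Finsupp.ext fun x ↦ ?_)
  have key (g : G) : MonoidAlgebra.coeff ((permRep k G H).ρ g⁻¹
      (cosetProj H k ((permRep k G H).ρ g p))) x =
        if g • x = (1 : G) then (Nat.card H : k)⁻¹ * MonoidAlgebra.coeff p x else 0 := by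
    refine (Representation.coeff_ofMulAction _ _ _).trans ((coeff_cosetProj H _ _).trans ?_)
    rw [inv_inv]
    congr 2
    exact (Representation.coeff_ofMulAction _ _ _).trans (by rw [inv_smul_smul])
  refine (DFunLike.congr_fun (MonoidAlgebra.coeff_sum (R := k) (M := G ⧸ H) _ _) x).trans ?_
  rw [Finsupp.finsetSum_apply, Finset.sum_congr rfl fun g _ ↦ key g,
    ← Finset.sum_filter, Finset.sum_const, card_filter_smul_eq_one, nsmul_eq_mul,
    mul_inv_cancel_left₀ hH]

theorem isZero_groupCohomology_tensor_permRep [Finite G] (hH : (Nat.card H : k) ≠ 0)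
    (V : Rep k G) (n : ℕ) : Limits.IsZero (groupCohomology (V ⊗ permRep k G H) (n + 1)) := by
  have := Fintype.ofFinite G
  refine isZero_groupCohomology_succ_of_sum_conj_eq_id _
    (LinearMap.lTensor V.V (cosetProj H k)) ?_ n
  refine TensorProduct.ext' fun v p ↦ ?_
  simp [← TensorProduct.tmul_sum, sum_conj_cosetProj H hH]

/-- The all-ones vector of `P`. -/
noncomputable def permOnes (k : Type) [Field k] [Finite G] : MonoidAlgebra k (G ⧸ H) :=
  .ofCoeff (Finsupp.equivFunOnFinite.symm 1)

theorem mem_invariants_iff_exists_smul_permOnes [Finite G] (p : MonoidAlgebra k (G ⧸ H)) :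
    p ∈ (Representation.ofMulAction k G (G ⧸ H)).invariants ↔ ∃ c : k, c • permOnes H k = p := by
  rw [Representation.mem_invariants]
  constructor
  · intro hp
    refine ⟨p.coeff (1 : G), MonoidAlgebra.ext (Finsupp.ext fun x ↦ ?_)⟩
    obtain ⟨g, hg⟩ := MulAction.exists_smul_eq G ((1 : G) : G ⧸ H) x
    have h := congr(MonoidAlgebra.coeff $(hp g) x)
    rw [Representation.coeff_ofMulAction, ← hg, inv_smul_smul] at h
    rw [← hg]
    exact (mul_one _).trans h
  · rintro ⟨c, rfl⟩ g
    refine MonoidAlgebra.ext (Finsupp.ext fun x ↦ ?_)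
    rw [Representation.coeff_ofMulAction]
    rfl

variable (k) in
/-- The inclusion of the constants, as a morphism `k ⟶ P`. -/
noncomputable def permConst [Finite G] : 𝟙_ (Rep k G) ⟶ permRep k G H :=
  ofHom ⟨LinearMap.toSpanSingleton k _ (permOnes H k), fun g ↦ by
    have h := (mem_invariants_iff_exists_smul_permOnes H (permOnes H k)).2 ⟨1, one_smul _ _⟩
    refine LinearMap.ext_ring ?_
    change (1 : k) • permOnes H k = Representation.ofMulAction k G _ g ((1 : k) • permOnes H k)
    rw [one_smul, (Representation.mem_invariants _ _).1 h g]⟩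

variable (k) in
/-- The quotient map `P ⟶ P / k`. -/
noncomputable def permMkQ : permRep k G H ⟶ permQuot k G H :=
  ofHom ⟨Submodule.mkQ _, fun _ ↦ rfl⟩

theorem exact_permConst_permMkQ [Finite G] :
    Function.Exact (permConst k H).hom (permMkQ k H).hom := fun p ↦
  (Submodule.Quotient.mk_eq_zero _).trans (mem_invariants_iff_exists_smul_permOnes H p)

variable (k) in
/-- The sequence `0 ⟶ k ⟶ P ⟶ P / k ⟶ 0`. -/
noncomputable def permShortComplex [Finite G] : ShortComplex (Rep k G) :=
  .mk (permConst k H) (permMkQ k H) <| hom_ext <| Representation.IntertwiningMap.ext <|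
    LinearMap.ext fun c ↦ (exact_permConst_permMkQ H).apply_apply_eq_zero c

theorem permShortComplex_shortExact [Finite G] : (permShortComplex k H).ShortExact :=
  shortExact_of_exact
    (fun (a b : k) h ↦ by
      have h1 : a * 1 = b * 1 := congr(MonoidAlgebra.coeff $h (1 : G))
      exact mul_left_injective₀ (one_ne_zero (α := k)) h1)
    (exact_permConst_permMkQ H)
    (Submodule.mkQ_surjective _)

theorem nonempty_groupCohomology_iso_tensor_permQuot [Finite G] (hH : (Nat.card H : k) ≠ 0)
    (V : Rep k G) (n : ℕ) :
    Nonempty (groupCohomology V (n + 2) ≅ groupCohomology (V ⊗ permQuot k G H) (n + 1)) := by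
  have hS := ShortExact.map_tensorLeft (permShortComplex_shortExact (k := k) H) V
  have := groupCohomology.isIso_δ_of_isZero hS (n + 1)
    (isZero_groupCohomology_tensor_permRep H hH V n)
    (isZero_groupCohomology_tensor_permRep H hH V (n + 1))
  exact ⟨(groupCohomology.functor k G (n + 2)).mapIso (ρ_ V).symm ≪≫
    (asIso (groupCohomology.δ hS (n + 1) (n + 2) rfl)).symm⟩

end PermutationModule

end Rep

/-- Let `G` be a finite group, `k` an algebraically closed field of
characteristic `r`, `H ≤ G` with `r` not dividing `|H|`, and `V` a `kG`-module. Then for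
all `n ≥ 2`, `H^n(G, V) ≅ Ext_G^{n-1}(V*, P/k) ≅ H^{n-1}(G, V ⊗ (P/k))`, where
`P = Ind_H^G k`. -/
theorem stmt7 {r : ℕ} [Fact r.Prime] {k G : Type} [Field k] [IsAlgClosed k] [CharP k r]
    [Group G] [Finite G] (H : Subgroup G) (hH : ¬ r ∣ Nat.card H)
    (V : Rep k G) [FiniteDimensional k V] :
    ∀ n : ℕ, 2 ≤ n →
      Nonempty (groupCohomology V n ≅
        ((Ext k (Rep k G) (n - 1)).obj (Opposite.op (Rep.of V.ρ.dual))).obj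
          (permQuot k G H)) ∧
      Nonempty (groupCohomology V n ≅ groupCohomology (V ⊗ permQuot k G H) (n - 1)) := by
  intro n hn
  obtain ⟨n, rfl⟩ := Nat.exists_eq_add_of_le' hn
  obtain ⟨e⟩ := Rep.nonempty_groupCohomology_iso_tensor_permQuot H
    (fun h ↦ hH ((CharP.cast_eq_zero_iff k r _).1 h)) V n
  exact ⟨⟨e ≪≫ Rep.groupCohomologyTensorIsoExt V (permQuot k G H) (n + 1)⟩, ⟨e⟩⟩
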